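/- arXiv:1101.0880 — 2 statements merged into one kernel-verified Lean document; each statement's English description precedes it below -/
import Mathlib

section
/- Every invertible linear map g : ℝ⁷ → ℝ⁷ whose pullback fixes the 3-form φ₀ (i.e. g*φ₀ = φ₀) is a special orthogonal transformation: g preserves the Euclidean inner product on ℝ⁷ and det g = 1. In other words, the stabilizer G₂ := {g ∈ GL(7,ℝ) ∣ g*φ₀ = φ₀} is contained in SO(7). -/
/-!
STATEMENT 3: Every invertible linear map `g : ℝ⁷ → ℝ⁷` whose pullback fixes `φ₀`
(`g*φ₀ = φ₀`, i.e. `φ₀(g·, g·, g·) = φ₀`) preserves the Euclidean inner product and has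
determinant 1; i.e. `G₂ ⊆ SO(7)`.

The pullback of the 3-form `φ₀` by `g` is `AlternatingMap.compLinearMap`.
-/

open scoped TensorProduct

noncomputable section

abbrev V7 : Type := Fin 7 → ℝ

/-- Wedge product of real-valued alternating forms (shuffle convention). -/
def wedge {k l : ℕ} (η : V7 [⋀^Fin k]→ₗ[ℝ] ℝ) (ζ : V7 [⋀^Fin l]→ₗ[ℝ] ℝ) :
    V7 [⋀^Fin (k + l)]→ₗ[ℝ] ℝ :=
  ((TensorProduct.lid ℝ ℝ).toLinearMap.compAlternatingMap (η.domCoprod ζ)).domDomCongr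
    finSumFinEquiv

/-- The wedge product `f 0 ∧ f 1 ∧ … ∧ f (k-1)` of `k` covectors. -/
def wedgeOf {k : ℕ} (f : Fin k → (V7 →ₗ[ℝ] ℝ)) : V7 [⋀^Fin k]→ₗ[ℝ] ℝ :=
  Matrix.detRowAlternating.compLinearMap (LinearMap.pi f)

/-- The coordinate covector `e^{i+1}` (0-based indexing: `e 0 = e¹`, …, `e 6 = e⁷`). -/
def e (i : Fin 7) : V7 →ₗ[ℝ] ℝ := LinearMap.proj i

/-- The standard G₂ 3-form
`φ₀ = (e^{12} − e^{34}) ∧ e⁵ + (e^{13} − e^{42}) ∧ e⁶ + (e^{14} − e^{23}) ∧ e⁷ + e^{567}`. -/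
def φ₀ : V7 [⋀^Fin 3]→ₗ[ℝ] ℝ :=
  wedgeOf ![e 0, e 1, e 4] - wedgeOf ![e 2, e 3, e 4]
    + wedgeOf ![e 0, e 2, e 5] - wedgeOf ![e 3, e 1, e 5]
    + wedgeOf ![e 0, e 3, e 6] - wedgeOf ![e 1, e 2, e 6]
    + wedgeOf ![e 4, e 5, e 6]

open AlternatingMap

lemma wedgeOf_three_apply (a b c : V7 →ₗ[ℝ] ℝ) (x : Fin 3 → V7) :
    wedgeOf ![a, b, c] x =
      a (x 0) * (b (x 1) * c (x 2) - c (x 1) * b (x 2))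
        + b (x 0) * (c (x 1) * a (x 2) - a (x 1) * c (x 2))
        + c (x 0) * (a (x 1) * b (x 2) - b (x 1) * a (x 2)) := by
  change Matrix.det (Matrix.of fun i => LinearMap.pi ![a, b, c] (x i)) = _
  rw [Matrix.det_fin_three]
  simp [LinearMap.pi_apply]
  ring

/-- The structure constants of `φ₀` in the standard basis. -/
def φ₀Coeff (a b c : Fin 7) : ℤ :=
  let δ (x i : Fin 7) : ℤ := if x = i then 1 else 0
  let d (i j k : Fin 7) : ℤ :=
    δ a i * (δ b j * δ c k - δ b k * δ c j)
      + δ a j * (δ b k * δ c i - δ b i * δ c k)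
      + δ a k * (δ b i * δ c j - δ b j * δ c i)
  d 0 1 4 - d 2 3 4 + d 0 2 5 - d 3 1 5 + d 0 3 6 - d 1 2 6 + d 4 5 6

lemma φ₀_basis (f : Fin 3 → Fin 7) :
    φ₀ (fun m => Pi.basisFun ℝ (Fin 7) (f m)) = (φ₀Coeff (f 0) (f 1) (f 2) : ℝ) := by
  simp only [φ₀, AlternatingMap.add_apply, AlternatingMap.sub_apply, wedgeOf_three_apply,
    φ₀Coeff, e, LinearMap.proj_apply, Pi.basisFun_apply, Pi.single_apply]
  push_cast
  simp only [eq_comm]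

/-- The contraction of `φ₀` with a vector, as a bilinear form. -/
def contraction (u : V7) : V7 →ₗ[ℝ] V7 →ₗ[ℝ] ℝ :=
  LinearMap.mk₂ ℝ (fun x y => φ₀ ![u, x, y])
    (by intros; simp [φ₀, wedgeOf_three_apply]; ring)
    (by intros; simp [φ₀, wedgeOf_three_apply]; ring)
    (by intros; simp [φ₀, wedgeOf_three_apply]; ring)
    (by intros; simp [φ₀, wedgeOf_three_apply]; ring)

lemma contraction_apply (u x y : V7) : contraction u x y = φ₀ ![u, x, y] := rfl

lemma contraction_eq_sum (u x y : V7) :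
    contraction u x y = ∑ c, u c * contraction (Pi.basisFun ℝ (Fin 7) c) x y := by
  simp [contraction_apply, φ₀, wedgeOf_three_apply, e, Fin.sum_univ_succ, Pi.single_apply]
  ring

lemma contraction_basis (a b c : Fin 7) :
    contraction (Pi.basisFun ℝ (Fin 7) a) (Pi.basisFun ℝ (Fin 7) b) (Pi.basisFun ℝ (Fin 7) c)
      = (φ₀Coeff a b c : ℝ) := by
  refine Eq.trans ?_ (φ₀_basis ![a, b, c])
  rw [contraction_apply]
  congr 1
  ext m : 1
  fin_cases m <;> rfl

/-- The wedge product of a bilinear form with an alternating form, up to normalization. -/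
def bilinWedge {n : ℕ} (ω : V7 →ₗ[ℝ] V7 →ₗ[ℝ] ℝ) (η : V7 [⋀^Fin n]→ₗ[ℝ] ℝ) :
    V7 [⋀^Fin (n + 2)]→ₗ[ℝ] ℝ :=
  alternatizeUncurryFin
    (alternatizeUncurryFinLM ∘ₗ ω.compr₂ (LinearMap.toSpanSingleton ℝ _ η))

lemma bilinWedge_apply {n : ℕ} (ω : V7 →ₗ[ℝ] V7 →ₗ[ℝ] ℝ) (η : V7 [⋀^Fin n]→ₗ[ℝ] ℝ)
    (x : Fin (n + 2) → V7) :
    bilinWedge ω η x = ∑ i : Fin (n + 2), ∑ j : Fin (n + 1), (-1) ^ (i + j : ℕ) *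
      (ω (x i) (x (i.succAbove j)) * η (fun k => x (i.succAbove (j.succAbove k)))) := by
  simp only [bilinWedge, alternatizeUncurryFin_apply, LinearMap.comp_apply,
    alternatizeUncurryFinLM_apply, LinearMap.compr₂_apply, LinearMap.toSpanSingleton_apply,
    AlternatingMap.smul_apply, Finset.smul_sum]
  refine Finset.sum_congr rfl fun i _ => Finset.sum_congr rfl fun j _ => ?_
  simp only [zsmul_eq_mul, smul_eq_mul]
  push_cast
  rw [pow_add, mul_assoc]
  rfl

lemma bilinWedge_comp {n : ℕ} {ω ω' : V7 →ₗ[ℝ] V7 →ₗ[ℝ] ℝ} {η η' : V7 [⋀^Fin n]→ₗ[ℝ] ℝ}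
    {g : V7 →ₗ[ℝ] V7} (hω : ∀ x y, ω (g x) (g y) = ω' x y) (hη : η.compLinearMap g = η') :
    (bilinWedge ω η).compLinearMap g = bilinWedge ω' η' := by
  subst hη
  ext x
  simp [bilinWedge_apply, hω]

set_option maxRecDepth 100000 in
lemma sum_φ₀Coeff_mul (c i : Fin 7) (j : Fin 6) :
    (-1) ^ (i + j : ℕ) * ∑ k : Fin 5, ∑ l : Fin 4, (-1) ^ (k + l : ℕ) *
      (φ₀Coeff c (i.succAbove (j.succAbove k)) (i.succAbove (j.succAbove (k.succAbove l))) *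
        φ₀Coeff (i.succAbove (j.succAbove (k.succAbove (l.succAbove 0))))
          (i.succAbove (j.succAbove (k.succAbove (l.succAbove 1))))
          (i.succAbove (j.succAbove (k.succAbove (l.succAbove 2))))) =
      -4 * φ₀Coeff c i (i.succAbove j) := by
  revert c i j
  decide +kernel

lemma bilinWedge_contraction_φ₀_basis (v : V7) (i : Fin 7) (j : Fin 6) :
    (-1) ^ (i + j : ℕ) * bilinWedge (contraction v) φ₀
        (fun k => Pi.basisFun ℝ (Fin 7) (i.succAbove (j.succAbove k))) =
      -4 * contraction v (Pi.basisFun ℝ (Fin 7) i) (Pi.basisFun ℝ (Fin 7) (i.succAbove j)) := by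
  have key (c : Fin 7) := congrArg (fun z : ℤ => v c * (z : ℝ)) (sum_φ₀Coeff_mul c i j)
  have := Finset.sum_congr (rfl : (Finset.univ : Finset (Fin 7)) = _) fun c _ => key c
  push_cast at this
  simp only [contraction_eq_sum v, contraction_basis, bilinWedge_apply, φ₀_basis]
  simp only [Finset.mul_sum, Finset.sum_mul] at this ⊢
  convert this using 1
  · symm
    rw [Finset.sum_comm]
    refine Finset.sum_congr rfl fun k _ => ?_
    rw [Finset.sum_comm]
    refine Finset.sum_congr rfl fun l _ => ?_
    refine Finset.sum_congr rfl fun c _ => ?_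
    ring
  · refine Finset.sum_congr rfl fun c _ => ?_
    ring

set_option maxRecDepth 100000 in
set_option maxHeartbeats 1000000 in
lemma sum_contraction_mul (u v : V7) :
    ∑ i : Fin 7, ∑ j : Fin 6,
      contraction u (Pi.basisFun ℝ (Fin 7) i) (Pi.basisFun ℝ (Fin 7) (i.succAbove j)) *
        contraction v (Pi.basisFun ℝ (Fin 7) i) (Pi.basisFun ℝ (Fin 7) (i.succAbove j)) =
      6 * ∑ i, u i * v i := by
  have diag (w x : V7) : contraction w x x = 0 := by
    simp [contraction_apply, φ₀, wedgeOf_three_apply]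
    ring
  have hsum (i : Fin 7) : ∑ j : Fin 6,
      contraction u (Pi.basisFun ℝ (Fin 7) i) (Pi.basisFun ℝ (Fin 7) (i.succAbove j)) *
        contraction v (Pi.basisFun ℝ (Fin 7) i) (Pi.basisFun ℝ (Fin 7) (i.succAbove j)) =
      ∑ k : Fin 7, contraction u (Pi.basisFun ℝ (Fin 7) i) (Pi.basisFun ℝ (Fin 7) k) *
        contraction v (Pi.basisFun ℝ (Fin 7) i) (Pi.basisFun ℝ (Fin 7) k) := by
    rw [Fin.sum_univ_succAbove _ i, diag, zero_mul, zero_add]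
  rw [Finset.sum_congr rfl fun i _ => hsum i]
  simp only [contraction_apply, φ₀, AlternatingMap.add_apply, AlternatingMap.sub_apply,
    wedgeOf_three_apply, e, LinearMap.proj_apply, Pi.basisFun_apply]
  simp [Fin.sum_univ_succ, Pi.single_apply]
  ring

/-- The top-degree form `ι_u φ₀ ∧ ι_v φ₀ ∧ φ₀`, up to normalization. -/
@[irreducible] def topForm (u v : V7) : V7 [⋀^Fin 7]→ₗ[ℝ] ℝ :=
  bilinWedge (contraction u) (bilinWedge (contraction v) φ₀)

lemma topForm_basis (u v : V7) :
    topForm u v (Pi.basisFun ℝ (Fin 7)) = -24 * ∑ i, u i * v i := by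
  calc
    _ = ∑ i : Fin 7, ∑ j : Fin 6, -4 *
        (contraction u (Pi.basisFun ℝ (Fin 7) i) (Pi.basisFun ℝ (Fin 7) (i.succAbove j)) *
          contraction v (Pi.basisFun ℝ (Fin 7) i) (Pi.basisFun ℝ (Fin 7) (i.succAbove j))) := by
      rw [topForm, bilinWedge_apply]
      refine Finset.sum_congr rfl fun i _ => Finset.sum_congr rfl fun j _ => ?_
      rw [mul_left_comm, bilinWedge_contraction_φ₀_basis]
      ring
    _ = -24 * ∑ i, u i * v i := by
      simp only [← Finset.mul_sum]
      rw [sum_contraction_mul]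
      ring

lemma compLinearMap_basis {ι R M : Type*} [Fintype ι] [DecidableEq ι] [CommRing R]
    [AddCommGroup M] [Module R M] (b : Module.Basis ι R M) (f : M [⋀^ι]→ₗ[R] R) (g : M →ₗ[R] M) :
    f.compLinearMap g b = LinearMap.det g * f b := by
  have h := AlternatingMap.congr_fun (f.eq_smul_basis_det b) (g ∘ b)
  rw [AlternatingMap.smul_apply, b.det_comp, b.det_self, mul_one, smul_eq_mul, mul_comm] at h
  exact h

/-- If `g` preserves `φ₀`, then it scales the Euclidean inner product by `(det g)⁻¹`. -/
lemma det_mul_sum_of_comp_φ₀ {g : V7 →ₗ[ℝ] V7} (hg : φ₀.compLinearMap g = φ₀) (u v : V7) :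
    LinearMap.det g * ∑ i, g u i * g v i = ∑ i, u i * v i := by
  have hc (u x y : V7) : contraction (g u) (g x) (g y) = contraction u x y := by
    have h := DFunLike.congr_fun hg ![u, x, y]
    rw [AlternatingMap.compLinearMap_apply] at h
    rw [contraction_apply, contraction_apply, ← h]
    congr 1
    ext m : 1
    fin_cases m <;> rfl
  have htop : (topForm (g u) (g v)).compLinearMap g = topForm u v := by
    rw [topForm, topForm]
    exact bilinWedge_comp (hc u) (bilinWedge_comp (hc v) hg)
  have h : (topForm (g u) (g v)).compLinearMap g (Pi.basisFun ℝ (Fin 7)) =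
      LinearMap.det g * topForm (g u) (g v) (Pi.basisFun ℝ (Fin 7)) :=
    compLinearMap_basis _ _ _
  rw [htop, topForm_basis, topForm_basis] at h
  linarith

lemma det_eq_one_of_comp_φ₀ {g : V7 →ₗ[ℝ] V7} (hg : φ₀.compLinearMap g = φ₀) :
    LinearMap.det g = 1 := by
  have hdet := LinearMap.det_toMatrix' g
  have hmul : LinearMap.det g • ((LinearMap.toMatrix' g).transpose * LinearMap.toMatrix' g) = 1 := by
    ext i j
    have h := det_mul_sum_of_comp_φ₀ hg (Pi.single i 1) (Pi.single j 1)
    simpa [Matrix.mul_apply, LinearMap.toMatrix'_apply, Matrix.one_apply,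
      Pi.single_apply, eq_comm] using h
  have h9 := congrArg Matrix.det hmul
  simp only [Matrix.det_smul, Matrix.det_mul, Matrix.det_transpose, hdet, Matrix.det_one,
    Fintype.card_fin] at h9
  have hpow : LinearMap.det g ^ 9 = 1 ^ 9 := by linear_combination h9
  exact (Odd.strictMono_pow (by decide : Odd 9)).injective hpow

theorem G2_subset_SO7 (g : V7 ≃ₗ[ℝ] V7)
    (hg : φ₀.compLinearMap (g : V7 →ₗ[ℝ] V7) = φ₀) :
    (∀ u v : V7, ∑ i, g u i * g v i = ∑ i, u i * v i) ∧
    LinearMap.det (g : V7 →ₗ[ℝ] V7) = 1 := by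
  have hdet := det_eq_one_of_comp_φ₀ hg
  refine ⟨fun u v => ?_, hdet⟩
  have h := det_mul_sum_of_comp_φ₀ hg u v
  rwa [hdet, one_mul] at h

end
end

section
/- Let H and H_i (i ∈ ℕ) be positive-definite Hermitian n×n complex matrices and σ(A, B) := tr(A⁻¹B) + tr(B⁻¹A) − 2n. Then the sequence H_i converges to H (in any norm on matrices) if and only if σ(H_i, H) → 0. -/
/-!
STATEMENT 13: Let `H` and `H_i` (`i ∈ ℕ`) be positive-definite Hermitian `n×n` complex
matrices and `σ(A,B) = tr(A⁻¹B) + tr(B⁻¹A) − 2n`.  Then `H_i → H` (in any norm on matrices,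
equivalently in the standard topology of the finite-dimensional matrix space) if and only if
`σ(H_i, H) → 0`.
-/

section FrobeniusEstimate

open scoped ComplexOrder MatrixOrder Matrix.Norms.Frobenius

namespace Matrix

variable {ι : Type*} [Fintype ι]

theorem frobenius_norm_sq_eq_re_trace (A : Matrix ι ι ℂ) : ‖A‖ ^ 2 = (Aᴴ * A).trace.re := by
  rw [frobenius_norm_def, ← Real.sqrt_eq_rpow, Real.sq_sqrt (by positivity), Finset.sum_comm]
  simp [trace, mul_apply, conjTranspose_apply, ← Complex.normSq_eq_norm_sq, Complex.normSq_apply]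

variable [DecidableEq ι]

theorem PosDef.exists_isUnit_eq_conjTranspose_mul_self {A : Matrix ι ι ℂ} (hA : A.PosDef) :
    ∃ Q : Matrix ι ι ℂ, IsUnit Q ∧ A = Qᴴ * Q := by
  obtain ⟨Q, rfl⟩ := CStarAlgebra.nonneg_iff_eq_star_mul_self.mp hA.posSemidef.nonneg
  exact ⟨Q, isUnit_of_mul_isUnit_right hA.isUnit, rfl⟩

theorem frobenius_norm_sq_sub_conjTranspose_inv {Y : Matrix ι ι ℂ} (hY : IsUnit Y) :
    ‖Y - (Y⁻¹)ᴴ‖ ^ 2 = ‖Y‖ ^ 2 + ‖Y⁻¹‖ ^ 2 - 2 * Fintype.card ι := by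
  have hd := (isUnit_iff_isUnit_det Y).mp hY
  have hc : Yᴴ * (Y⁻¹)ᴴ = 1 := by rw [← conjTranspose_mul, nonsing_inv_mul _ hd, conjTranspose_one]
  have he : (Y - (Y⁻¹)ᴴ)ᴴ * (Y - (Y⁻¹)ᴴ) = Yᴴ * Y + Y⁻¹ * (Y⁻¹)ᴴ - 1 - 1 := by
    rw [conjTranspose_sub, conjTranspose_conjTranspose, sub_mul, mul_sub, mul_sub, hc,
      nonsing_inv_mul _ hd]
    abel
  rw [frobenius_norm_sq_eq_re_trace, he, frobenius_norm_sq_eq_re_trace Y,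
    frobenius_norm_sq_eq_re_trace Y⁻¹, trace_mul_comm (Y⁻¹)ᴴ]
  simp [trace_one]
  ring

theorem PosDef.exists_frobenius_norm_sub_sq_le {A : Matrix ι ι ℂ} (hA : A.PosDef) :
    ∃ C : ℝ, ∀ B : Matrix ι ι ℂ, B.PosDef → ∀ s : ℝ,
      s = ((B⁻¹ * A).trace + (A⁻¹ * B).trace).re - 2 * Fintype.card ι →
        ‖B - A‖ ^ 2 ≤ C * (s * (s + 2 * Fintype.card ι)) := by
  obtain ⟨Q, hQ, rfl⟩ := hA.exists_isUnit_eq_conjTranspose_mul_self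
  refine ⟨(‖Qᴴ‖ * ‖Q‖) ^ 2, fun B hB s hs => ?_⟩
  obtain ⟨P, hP, rfl⟩ := hB.exists_isUnit_eq_conjTranspose_mul_self
  have hQd := (isUnit_iff_isUnit_det Q).mp hQ
  have hQc : (Qᴴ)⁻¹ * Qᴴ = 1 := nonsing_inv_mul _ (by simpa [det_conjTranspose] using hQd)
  obtain ⟨Y, rfl⟩ : ∃ Y, P = Y * Q := ⟨P * Q⁻¹, by rw [nonsing_inv_mul_cancel_right _ _ hQd]⟩
  have hY : IsUnit Y := isUnit_of_mul_isUnit_left hP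
  have hYd := (isUnit_iff_isUnit_det Y).mp hY
  have hs₁ : (((Y * Q)ᴴ * (Y * Q))⁻¹ * (Qᴴ * Q)).trace = ((Y⁻¹)ᴴ * Y⁻¹).trace := by
    calc _ = (Q⁻¹ * (Y⁻¹ * (Y⁻¹)ᴴ * ((Qᴴ)⁻¹ * Qᴴ) * Q)).trace := by
          simp only [conjTranspose_mul, mul_inv_rev, conjTranspose_nonsing_inv, Matrix.mul_assoc]
      _ = _ := by
          rw [hQc, mul_one, trace_mul_comm, mul_nonsing_inv_cancel_right _ _ hQd, trace_mul_comm]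
  have hs₂ : ((Qᴴ * Q)⁻¹ * ((Y * Q)ᴴ * (Y * Q))).trace = (Yᴴ * Y).trace := by
    calc _ = (Q⁻¹ * ((Qᴴ)⁻¹ * Qᴴ * (Yᴴ * Y) * Q)).trace := by
          simp only [conjTranspose_mul, mul_inv_rev, Matrix.mul_assoc]
      _ = _ := by rw [hQc, one_mul, trace_mul_comm, mul_nonsing_inv_cancel_right _ _ hQd]
  rw [hs₁, hs₂, Complex.add_re, ← frobenius_norm_sq_eq_re_trace,
    ← frobenius_norm_sq_eq_re_trace] at hs
  have hX : ‖Y - (Y⁻¹)ᴴ‖ ^ 2 = s := by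
    rw [frobenius_norm_sq_sub_conjTranspose_inv hY, hs]; ring
  have hYs : ‖Y‖ ^ 2 ≤ s + 2 * Fintype.card ι := by nlinarith [sq_nonneg ‖Y⁻¹‖]
  have hsub : (Y * Q)ᴴ * (Y * Q) - Qᴴ * Q = Qᴴ * (Yᴴ * (Y - (Y⁻¹)ᴴ)) * Q := by
    rw [mul_sub Yᴴ, ← conjTranspose_mul Y⁻¹, nonsing_inv_mul _ hYd, conjTranspose_one, mul_sub,
      sub_mul, mul_one, conjTranspose_mul]
    simp only [Matrix.mul_assoc]
  have hnorm : ‖Qᴴ * (Yᴴ * (Y - (Y⁻¹)ᴴ)) * Q‖ ≤ ‖Qᴴ‖ * (‖Y‖ * ‖Y - (Y⁻¹)ᴴ‖) * ‖Q‖ := by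
    refine (frobenius_norm_mul _ _).trans ?_
    gcongr
    refine (frobenius_norm_mul _ _).trans ?_
    gcongr
    refine (frobenius_norm_mul _ _).trans ?_
    rw [frobenius_norm_conjTranspose]
  calc _ ≤ (‖Qᴴ‖ * (‖Y‖ * ‖Y - (Y⁻¹)ᴴ‖) * ‖Q‖) ^ 2 := by rw [hsub]; gcongr
    _ = (‖Qᴴ‖ * ‖Q‖) ^ 2 * (‖Y - (Y⁻¹)ᴴ‖ ^ 2 * ‖Y‖ ^ 2) := by ring
    _ ≤ _ := by rw [hX]; have := hX ▸ sq_nonneg ‖Y - (Y⁻¹)ᴴ‖; gcongr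

theorem PosDef.tendsto_of_tendsto_trace {A : Matrix ι ι ℂ} (hA : A.PosDef) {α : Type*}
    {l : Filter α} {B : α → Matrix ι ι ℂ} (hB : ∀ i, (B i).PosDef)
    (h : Filter.Tendsto
      (fun i => (((B i)⁻¹ * A).trace + (A⁻¹ * B i).trace).re - 2 * Fintype.card ι) l (nhds 0)) :
    Filter.Tendsto B l (nhds A) := by
  obtain ⟨C, hC⟩ := hA.exists_frobenius_norm_sub_sq_le
  refine tendsto_iff_norm_sub_tendsto_zero.mpr ?_
  have hsq : Filter.Tendsto (fun i => ‖B i - A‖ ^ 2) l (nhds 0) := by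
    refine squeeze_zero (fun _ => sq_nonneg _) (fun i => hC (B i) (hB i) _ rfl) ?_
    simpa using (h.mul (h.add_const (2 * (Fintype.card ι : ℝ)))).const_mul C
  simpa [Real.sqrt_sq] using hsq.sqrt

end Matrix

end FrobeniusEstimate

open scoped ComplexOrder in
theorem matrix_convergence_iff_sigma_tendsto_zero {n : ℕ}
    (H : Matrix (Fin n) (Fin n) ℂ) (Hs : ℕ → Matrix (Fin n) (Fin n) ℂ)
    (hH : H.PosDef) (hHs : ∀ i, (Hs i).PosDef) :
    Filter.Tendsto Hs Filter.atTop (nhds H) ↔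
      Filter.Tendsto
        (fun i => (((Hs i)⁻¹ * H).trace + (H⁻¹ * Hs i).trace).re - 2 * n)
        Filter.atTop (nhds 0) := by
  refine ⟨fun h => ?_, fun h => hH.tendsto_of_tendsto_trace hHs (by simpa using h)⟩
  have hd : IsUnit H.det := (Matrix.isUnit_iff_isUnit_det H).mp hH.isUnit
  have hinv : Filter.Tendsto (fun i => (Hs i)⁻¹) Filter.atTop (nhds H⁻¹) := by
    refine (continuousAt_matrix_inv H ?_).tendsto.comp h
    rw [Ring.inverse_eq_inv']
    exact continuousAt_inv₀ hd.ne_zero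
  have htr : Continuous (fun M : Matrix (Fin n) (Fin n) ℂ => M.trace) := continuous_id.matrix_trace
  have h₁ := (htr.tendsto _).comp (hinv.mul_const H)
  have h₂ := (htr.tendsto _).comp (h.const_mul H⁻¹)
  rw [Matrix.nonsing_inv_mul _ hd, Matrix.trace_one, Fintype.card_fin] at h₁ h₂
  have h₃ := ((Complex.continuous_re.tendsto _).comp (h₁.add h₂)).sub_const (2 * (n : ℝ))
  have hzero : ((n : ℂ) + n).re - 2 * (n : ℝ) = 0 := by simp; ring
  rw [hzero] at h₃
  exact h₃
end
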